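/- With notation and hypotheses as in the context, B(e₀, e₃) = B(e₃, e₀) = (λ𝔭λ𝔭̄/(εp+1)²)·c. -/

import Mathlib

open Matrix

/-- The matrix of the Hecke operator `U𝔭` in the basis
`[μ], υ𝔭*·[μ], υ𝔭̄*·[μ], υ𝔭*υ𝔭̄*·[μ]`. -/
noncomputable def Ufp (p k : ℕ) (lp : ℂ) : Matrix (Fin 4) (Fin 4) ℂ :=
  !![lp, (p : ℂ) ^ (k + 1), 0, 0;
     -1, 0, 0, 0;
     0, 0, lp, (p : ℂ) ^ (k + 1);
     0, 0, -1, 0]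

/-- The matrix of the Hecke operator `U𝔭̄` in the same basis. -/
noncomputable def Ufpb (p k : ℕ) (lpb : ℂ) : Matrix (Fin 4) (Fin 4) ℂ :=
  !![lpb, 0, (p : ℂ) ^ (k + 1), 0;
     0, lpb, 0, (p : ℂ) ^ (k + 1);
     -1, 0, 0, 0;
     0, -1, 0, 0]

/-- The matrix of the partial Atkin–Lehner operator `ω𝔭` (with `ε = (−1)^k`). -/
noncomputable def Wfp (p k : ℕ) : Matrix (Fin 4) (Fin 4) ℂ :=
  !![0, (p : ℂ) ^ k, 0, 0;
     (-1 : ℂ) ^ k, 0, 0, 0;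
     0, 0, 0, (p : ℂ) ^ k;
     0, 0, (-1 : ℂ) ^ k, 0]

/-- The matrix of the partial Atkin–Lehner operator `ω𝔭̄` (with `ε = (−1)^k`). -/
noncomputable def Wfpb (p k : ℕ) : Matrix (Fin 4) (Fin 4) ℂ :=
  !![0, 0, (p : ℂ) ^ k, 0;
     0, 0, 0, (p : ℂ) ^ k;
     (-1 : ℂ) ^ k, 0, 0, 0;
     0, (-1 : ℂ) ^ k, 0, 0]

/-- The Atkin–Lehner matrix `ω_p = ω𝔭·ω𝔭̄`. -/
noncomputable def Wp (p k : ℕ) : Matrix (Fin 4) (Fin 4) ℂ := Wfp p k * Wfpb p k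

/-- The adjoint `U𝔭* = ω_p⁻¹·U𝔭·ω_p`. -/
noncomputable def UfpStar (p k : ℕ) (lp : ℂ) : Matrix (Fin 4) (Fin 4) ℂ :=
  (Wp p k)⁻¹ * Ufp p k lp * Wp p k

/-- The adjoint `U𝔭̄* = ω_p⁻¹·U𝔭̄·ω_p`. -/
noncomputable def UfpbStar (p k : ℕ) (lpb : ℂ) : Matrix (Fin 4) (Fin 4) ℂ :=
  (Wp p k)⁻¹ * Ufpb p k lpb * Wp p k

/-- The standard basis `e₀, e₁, e₂, e₃` of `ℂ⁴`. -/
noncomputable def e (i : Fin 4) : Fin 4 → ℂ := Pi.single i 1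

theorem Wp_eq (p k : ℕ) : Wp p k =
    !![0, 0, 0, (p : ℂ) ^ k * (p : ℂ) ^ k;
       0, 0, (-1 : ℂ) ^ k * (p : ℂ) ^ k, 0;
       0, (-1 : ℂ) ^ k * (p : ℂ) ^ k, 0, 0;
       1, 0, 0, 0] := by
  have hε : (-1 : ℂ) ^ k * (-1 : ℂ) ^ k = 1 := by rw [← mul_pow]; simp
  ext i j
  fin_cases i <;> fin_cases j <;>
    simp [Wp, Wfp, Wfpb, Matrix.mul_apply, Fin.sum_univ_four, hε, mul_comm]

theorem isUnit_det_Wp {p : ℕ} (k : ℕ) (hp : p ≠ 0) : IsUnit (Wp p k).det := by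
  have hP : (p : ℂ) ^ k ≠ 0 := pow_ne_zero _ (Nat.cast_ne_zero.mpr hp)
  have hε : (-1 : ℂ) ^ k * (-1 : ℂ) ^ k = 1 := by rw [← mul_pow]; simp
  have h : Wp p k * Wp p k = ((p : ℂ) ^ k * (p : ℂ) ^ k) • 1 := by
    rw [Wp_eq]
    ext i j
    fin_cases i <;> fin_cases j <;>
      simp [Matrix.mul_apply, Fin.sum_univ_four]
    all_goals linear_combination (p : ℂ) ^ k * (p : ℂ) ^ k * hε
  refine Matrix.isUnit_det_of_right_inverse
    (B := ((p : ℂ) ^ k * (p : ℂ) ^ k)⁻¹ • Wp p k) ?_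
  rw [Matrix.mul_smul, h, smul_smul, inv_mul_cancel₀ (mul_ne_zero hP hP), one_smul]

theorem conj_mulVec_eq {n : Type*} [Fintype n] [DecidableEq n] {W U : Matrix n n ℂ}
    (hW : IsUnit W.det) {v w : n → ℂ} (h : U *ᵥ (W *ᵥ v) = W *ᵥ w) :
    (W⁻¹ * U * W) *ᵥ v = w := by
  rw [← Matrix.mulVec_mulVec, ← Matrix.mulVec_mulVec, h, Matrix.mulVec_mulVec,
    Matrix.nonsing_inv_mul _ hW, Matrix.one_mulVec]

/-- If `U` and `S` are mutually adjoint for `B`, with `U x = l x - y` and `S x = q y` (and likewise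
for `x'`, `y'`), then pairings involving one of `y`, `y'` reduce to the pairing of `x` and `x'`. -/
theorem pairing_of_adjoint {V : Type*} [AddCommGroup V] [Module ℂ V] {B : V → V → ℂ}
    (haddl : ∀ x x' y, B (x + x') y = B x y + B x' y)
    (haddr : ∀ x y y', B x (y + y') = B x y + B x y')
    (hsmull : ∀ (a : ℂ) (x y : V), B (a • x) y = a * B x y)
    (hsmulr : ∀ (a : ℂ) (x y : V), B x (a • y) = (starRingEnd ℂ) a * B x y)
    {U S : V → V} (hU : ∀ x y, B (U x) y = B x (S y)) (hS : ∀ x y, B (S x) y = B x (U y))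
    {l q : ℝ} (hq : (q : ℂ) ^ 2 ≠ 1) {x y x' y' : V}
    (hx : U x = (l : ℂ) • x + (-1 : ℂ) • y) (hSx : S x = (q : ℂ) • y)
    (hx' : U x' = (l : ℂ) • x' + (-1 : ℂ) • y') (hSx' : S x' = (q : ℂ) • y') :
    B x y' = l / (q + 1) * B x x' ∧ B y x' = l / (q + 1) * B x x' := by
  have h₁ := hU x x'
  have h₂ := hS x x'
  simp only [hx, hSx, hx', hSx', haddl, haddr, hsmull, hsmulr, Complex.conj_ofReal, map_neg,
    map_one] at h₁ h₂
  have hadd : (q : ℂ) + 1 ≠ 0 := fun h => hq (by linear_combination ((q : ℂ) - 1) * h)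
  have hsub : (q : ℂ) ^ 2 - 1 ≠ 0 := sub_ne_zero.mpr hq
  have heq : B x y' = l / (q + 1) * B x x' := by
    rw [div_mul_eq_mul_div, eq_div_iff hadd]
    apply mul_left_cancel₀ (sub_ne_zero.mpr fun h => hq (by rw [h]; ring) : (q : ℂ) - 1 ≠ 0)
    linear_combination -(q : ℂ) * h₁ - h₂
  refine ⟨heq, ?_⟩
  have hy : B y x' = l * B x x' - q * B x y' := by linear_combination -h₁
  rw [hy, heq]
  field_simp
  ring

section HeckeAction

variable (p k : ℕ) (l : ℂ)

theorem Ufp_mulVec_e_zero : Ufp p k l *ᵥ e 0 = l • e 0 + (-1 : ℂ) • e 1 := by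
  ext i
  fin_cases i <;> simp [Ufp, e]

theorem Ufp_mulVec_e_two : Ufp p k l *ᵥ e 2 = l • e 2 + (-1 : ℂ) • e 3 := by
  ext i
  fin_cases i <;> simp [Ufp, e]

theorem Ufpb_mulVec_e_zero : Ufpb p k l *ᵥ e 0 = l • e 0 + (-1 : ℂ) • e 2 := by
  ext i
  fin_cases i <;> simp [Ufpb, e]

variable {p}

theorem UfpStar_mulVec_e_zero (hp : p ≠ 0) :
    UfpStar p k l *ᵥ e 0 = ((-1 : ℂ) ^ k * p) • e 1 := by
  have hε : (-1 : ℂ) ^ k * (-1 : ℂ) ^ k = 1 := by rw [← mul_pow]; simp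
  refine conj_mulVec_eq (isUnit_det_Wp k hp) ?_
  rw [Wp_eq]
  ext i
  fin_cases i <;> simp [Ufp, e, Matrix.mulVec, dotProduct, Fin.sum_univ_four]
  linear_combination -(p : ℂ) ^ (k + 1) * hε

theorem UfpStar_mulVec_e_two (hp : p ≠ 0) :
    UfpStar p k l *ᵥ e 2 = ((-1 : ℂ) ^ k * p) • e 3 := by
  refine conj_mulVec_eq (isUnit_det_Wp k hp) ?_
  rw [Wp_eq]
  ext i
  fin_cases i <;> simp [Ufp, e, Matrix.mulVec, dotProduct, Fin.sum_univ_four]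
  ring

theorem UfpbStar_mulVec_e_zero (hp : p ≠ 0) :
    UfpbStar p k l *ᵥ e 0 = ((-1 : ℂ) ^ k * p) • e 2 := by
  have hε : (-1 : ℂ) ^ k * (-1 : ℂ) ^ k = 1 := by rw [← mul_pow]; simp
  refine conj_mulVec_eq (isUnit_det_Wp k hp) ?_
  rw [Wp_eq]
  ext i
  fin_cases i <;> simp [Ufpb, e, Matrix.mulVec, dotProduct, Fin.sum_univ_four]
  linear_combination -(p : ℂ) ^ (k + 1) * hε

end HeckeAction

/-- Values of the twisted Poincaré pairing: `B(e₀,e₃) = B(e₃,e₀) = (λ𝔭λ𝔭̄/(εp+1)²)·c`,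
where `ε = (−1)^k` and `c = B(e₀,e₀)`. -/
theorem stmt_10 (p k : ℕ) (hp : p.Prime) (hp3 : 3 ≤ p) (lp lpb : ℝ)
    (B : (Fin 4 → ℂ) → (Fin 4 → ℂ) → ℂ)
    (haddl : ∀ x x' y, B (x + x') y = B x y + B x' y)
    (haddr : ∀ x y y', B x (y + y') = B x y + B x y')
    (hsmull : ∀ (a : ℂ) (x y : Fin 4 → ℂ), B (a • x) y = a * B x y)
    (hsmulr : ∀ (a : ℂ) (x y : Fin 4 → ℂ), B x (a • y) = (starRingEnd ℂ) a * B x y)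
    (hU : ∀ x y, B ((Ufp p k (lp : ℂ)).mulVec x) y = B x ((UfpStar p k (lp : ℂ)).mulVec y))
    (hUs : ∀ x y, B ((UfpStar p k (lp : ℂ)).mulVec x) y = B x ((Ufp p k (lp : ℂ)).mulVec y))
    (hV : ∀ x y, B ((Ufpb p k (lpb : ℂ)).mulVec x) y = B x ((UfpbStar p k (lpb : ℂ)).mulVec y))
    (hVs : ∀ x y, B ((UfpbStar p k (lpb : ℂ)).mulVec x) y = B x ((Ufpb p k (lpb : ℂ)).mulVec y))
    :
    B (e 0) (e 3) =
      ((lp : ℂ) * (lpb : ℂ) / ((-1 : ℂ) ^ k * (p : ℂ) + 1) ^ 2) * B (e 0) (e 0) ∧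
    B (e 3) (e 0) =
      ((lp : ℂ) * (lpb : ℂ) / ((-1 : ℂ) ^ k * (p : ℂ) + 1) ^ 2) * B (e 0) (e 0) := by
  have hq : (((-1 : ℝ) ^ k * p : ℝ) : ℂ) = (-1 : ℂ) ^ k * p := by push_cast; rfl
  have hq2 : (((-1 : ℝ) ^ k * p : ℝ) : ℂ) ^ 2 ≠ 1 := by
    rw [hq, mul_pow, ← pow_mul, mul_comm k 2, pow_mul, neg_one_sq, one_pow, one_mul]
    exact_mod_cast (Nat.one_lt_pow two_ne_zero hp.one_lt).ne'
  have hS0 := UfpStar_mulVec_e_zero k (lp : ℂ) hp.ne_zero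
  have hS2 := UfpStar_mulVec_e_two k (lp : ℂ) hp.ne_zero
  have hT0 := UfpbStar_mulVec_e_zero k (lpb : ℂ) hp.ne_zero
  rw [← hq] at hS0 hS2 hT0
  have hU0 := Ufp_mulVec_e_zero p k (lp : ℂ)
  have hU2 := Ufp_mulVec_e_two p k (lp : ℂ)
  have hV0 := Ufpb_mulVec_e_zero p k (lpb : ℂ)
  have h03 := (pairing_of_adjoint haddl haddr hsmull hsmulr hU hUs hq2 hU0 hS0 hU2 hS2).1
  have h30 := (pairing_of_adjoint haddl haddr hsmull hsmulr hU hUs hq2 hU2 hS2 hU0 hS0).2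
  obtain ⟨h02, h20⟩ :=
    pairing_of_adjoint haddl haddr hsmull hsmulr hV hVs hq2 hV0 hT0 hV0 hT0
  rw [h03, h30, h02, h20, hq, ← mul_assoc, div_mul_div_comm, ← sq]
  exact ⟨rfl, rfl⟩
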